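/- arXiv:1409.5701 — 3 statements merged into one kernel-verified Lean document; each statement's English description precedes it below -/
import Mathlib

section
/- Let E be a finite subgroup of odd order of GL(3, F₂). Then E is isomorphic to one of: the trivial group, the cyclic group of order 3, the cyclic group of order 7, or a nonabelian group of order 21. -/
open Polynomial in
/-- Every element of `GL(3, F₂)` has order dividing `3`, `4` or `7`. -/
theorem pow_three_or_four_or_seven_eq_one (g : GL (Fin 3) (ZMod 2)) :
    g ^ 3 = 1 ∨ g ^ 4 = 1 ∨ g ^ 7 = 1 := by
  have pow_eq_one (n : ℕ) (h : (g : Matrix (Fin 3) (Fin 3) (ZMod 2)).charpoly ∣ X ^ n - 1) :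
      g ^ n = 1 := by
    obtain ⟨q, hq⟩ := h
    have h0 := congrArg (aeval (g : Matrix (Fin 3) (Fin 3) (ZMod 2))) hq
    rw [map_mul, Matrix.aeval_self_charpoly, zero_mul] at h0
    simp only [map_sub, map_pow, aeval_X, map_one] at h0
    exact Units.ext (by simpa using sub_eq_zero.mp h0)
  have hdet : (g : Matrix (Fin 3) (Fin 3) (ZMod 2)).det ≠ 0 :=
    (Matrix.isUnits_det_units g).ne_zero
  rw [Matrix.det_eq_sign_charpoly_coeff] at hdet
  set p := (g : Matrix (Fin 3) (Fin 3) (ZMod 2)).charpoly with hp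
  have hmonic : p.Monic := Matrix.charpoly_monic _
  have hdeg : p.natDegree = 3 := by simp [hp]
  have h3 : p.coeff 3 = 1 := by simpa [hdeg] using hmonic.coeff_natDegree
  have eq_zero_or_one : ∀ a : ZMod 2, a = 0 ∨ a = 1 := by decide
  have h0 : p.coeff 0 = 1 :=
    (eq_zero_or_one _).resolve_left fun h => hdet (by rw [h, mul_zero])
  have hsum : p = 1 + C (p.coeff 1) * X + C (p.coeff 2) * X ^ 2 + X ^ 3 := by
    conv_lhs => rw [p.as_sum_range_C_mul_X_pow, hdeg]
    simp [Finset.sum_range_succ, h0, h3]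
  have htwo : (2 : (ZMod 2)[X]) = 0 := CharTwo.two_eq_zero
  rcases eq_zero_or_one (p.coeff 1) with h1 | h1 <;>
    rcases eq_zero_or_one (p.coeff 2) with h2 | h2 <;>
    simp only [h1, h2, map_zero, map_one, zero_mul, one_mul, add_zero] at hsum
  · refine Or.inl (pow_eq_one 3 ⟨1, ?_⟩)
    rw [hsum]
    linear_combination -htwo
  · refine Or.inr (Or.inr (pow_eq_one 7 ⟨X ^ 4 + X ^ 3 + X ^ 2 + 1, ?_⟩))
    rw [hsum]
    linear_combination (-1 - X ^ 2 - X ^ 3 - X ^ 4 - X ^ 5 - X ^ 6) * htwo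
  · refine Or.inr (Or.inr (pow_eq_one 7 ⟨X ^ 4 + X ^ 2 + X + 1, ?_⟩))
    rw [hsum]
    linear_combination (-1 - X - X ^ 2 - X ^ 3 - X ^ 4 - X ^ 5) * htwo
  · refine Or.inr (Or.inl (pow_eq_one 4 ⟨X + 1, ?_⟩))
    rw [hsum]
    linear_combination (-1 - X - X ^ 2 - X ^ 3) * htwo

/-- A group of order `21` whose elements all commute has an element of order `21`. -/
theorem exists_orderOf_eq_twentyOne {G : Type*} [Group G] (hG : Nat.card G = 21)
    (hcomm : ∀ a b : G, a * b = b * a) : ∃ g : G, orderOf g = 21 := by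
  have : Finite G := Nat.finite_of_card_ne_zero (by omega)
  have : Fact (Nat.Prime 3) := ⟨by norm_num⟩
  have : Fact (Nat.Prime 7) := ⟨by norm_num⟩
  obtain ⟨a, ha⟩ := exists_prime_orderOf_dvd_card' (G := G) 3 (by rw [hG]; norm_num)
  obtain ⟨b, hb⟩ := exists_prime_orderOf_dvd_card' (G := G) 7 (by rw [hG]; norm_num)
  refine ⟨a * b, ?_⟩
  rw [(show Commute a b from hcomm a b).orderOf_mul_eq_mul_orderOf_of_coprime
    (by rw [ha, hb]; norm_num), ha, hb]

/-- Any odd-order subgroup of `GL(3, F₂)` is trivial, cyclic of order 3, cyclic of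
order 7, or a nonabelian group of order 21. -/
theorem stmt_1 (E : Subgroup (GL (Fin 3) (ZMod 2))) (hE : Odd (Nat.card E)) :
    Nonempty (E ≃* Multiplicative (ZMod 1)) ∨
    Nonempty (E ≃* Multiplicative (ZMod 3)) ∨
    Nonempty (E ≃* Multiplicative (ZMod 7)) ∨
    (Nat.card E = 21 ∧ ¬ (∀ a b : E, a * b = b * a)) := by
  have hGL : Nat.card (GL (Fin 3) (ZMod 2)) = 8 * 21 := by
    rw [Matrix.card_GL_field]
    simp [Fin.prod_univ_succ, ZMod.card]
  have hdvd : Nat.card E ∣ 21 := by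
    have h := E.card_subgroup_dvd_card
    rw [hGL] at h
    exact (Nat.Coprime.pow_right 3 hE.coprime_two_right).dvd_of_dvd_mul_left h
  have : Fact (Nat.Prime 3) := ⟨by norm_num⟩
  have : Fact (Nat.Prime 7) := ⟨by norm_num⟩
  have hcases : Nat.card E ∈ ({1, 3, 7, 21} : Finset ℕ) := by
    rw [show ({1, 3, 7, 21} : Finset ℕ) = Nat.divisors 21 by decide]
    exact Nat.mem_divisors.mpr ⟨hdvd, by norm_num⟩
  simp only [Finset.mem_insert, Finset.mem_singleton] at hcases
  rcases hcases with h | h | h | h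
  · have := (Nat.card_eq_one_iff_unique.mp h).1
    exact Or.inl ⟨mulEquivOfCyclicCardEq (by simp)⟩
  · exact Or.inr (Or.inl ⟨mulEquivOfPrimeCardEq (p := 3) h (by simp)⟩)
  · exact Or.inr (Or.inr (Or.inl ⟨mulEquivOfPrimeCardEq (p := 7) h (by simp)⟩))
  · refine Or.inr (Or.inr (Or.inr ⟨h, fun hcomm => ?_⟩))
    obtain ⟨g, hg⟩ := exists_orderOf_eq_twentyOne h hcomm
    rw [← Subgroup.orderOf_coe] at hg
    rcases pow_three_or_four_or_seven_eq_one (g : GL (Fin 3) (ZMod 2)) with h | h | h <;>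
    · have := orderOf_dvd_of_pow_eq_one h
      rw [hg] at this
      norm_num at this
end

section
/- Every automorphism of SL₂(F₈) is the composite of an inner automorphism with the automorphism induced by entrywise application of a field automorphism of F₈; that is, for every group automorphism φ of SL₂(F₈) there exist g ∈ SL₂(F₈) and a ring automorphism σ of F₈ such that φ(A) = g · σ(A) · g⁻¹ for all A ∈ SL₂(F₈), where σ(A) denotes the matrix obtained by applying σ to each entry of A. -/
namespace SLTwoCharTwo

open Matrix

variable {K : Type*} [Field K]

/-- The upper unitriangular matrix with off-diagonal entry `x`. -/
def upper (x : K) : SpecialLinearGroup (Fin 2) K :=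
  ⟨!![1, x; 0, 1], by simp⟩

/-- The diagonal matrix with entries `t` and `t⁻¹`. -/
def torus (t : K) (ht : t ≠ 0) : SpecialLinearGroup (Fin 2) K :=
  ⟨!![t, 0; 0, t⁻¹], by simp [ht]⟩

/-- The matrix exchanging the two basis vectors, of determinant `-1 = 1`. -/
def swap [CharP K 2] : SpecialLinearGroup (Fin 2) K :=
  ⟨!![0, 1; 1, 0], by simp [CharTwo.neg_eq]⟩

lemma ext_iff_entries (A B : SpecialLinearGroup (Fin 2) K) :
    A = B ↔ A 0 0 = B 0 0 ∧ A 0 1 = B 0 1 ∧ A 1 0 = B 1 0 ∧ A 1 1 = B 1 1 := by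
  constructor
  · rintro rfl
    simp
  · rintro ⟨h₁, h₂, h₃, h₄⟩
    ext i j
    fin_cases i <;> fin_cases j <;> assumption

lemma mul_entry (A B : SpecialLinearGroup (Fin 2) K) (i j : Fin 2) :
    (A * B) i j = A i 0 * B 0 j + A i 1 * B 1 j := by
  simp [Matrix.mul_apply, Fin.sum_univ_two]

lemma det_entries (A : SpecialLinearGroup (Fin 2) K) :
    A 0 0 * A 1 1 - A 0 1 * A 1 0 = 1 := by
  rw [← Matrix.det_fin_two]
  exact A.det_coe

lemma exists_of_entries {a b c d : K} (h : a * d - b * c = 1) :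
    ∃ A : SpecialLinearGroup (Fin 2) K,
      A 0 0 = a ∧ A 0 1 = b ∧ A 1 0 = c ∧ A 1 1 = d :=
  ⟨⟨!![a, b; c, d], by rw [Matrix.det_fin_two_of, h]⟩, rfl, rfl, rfl, rfl⟩

section Entries

variable (x t : K) (ht : t ≠ 0)

lemma one_zero_zero : (1 : SpecialLinearGroup (Fin 2) K) 0 0 = 1 := rfl
lemma one_zero_one : (1 : SpecialLinearGroup (Fin 2) K) 0 1 = 0 := rfl
lemma one_one_zero : (1 : SpecialLinearGroup (Fin 2) K) 1 0 = 0 := rfl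
lemma one_one_one : (1 : SpecialLinearGroup (Fin 2) K) 1 1 = 1 := rfl
@[simp] lemma upper_zero_zero : upper x 0 0 = 1 := rfl
@[simp] lemma upper_zero_one : upper x 0 1 = x := rfl
@[simp] lemma upper_one_zero : upper x 1 0 = 0 := rfl
@[simp] lemma upper_one_one : upper x 1 1 = 1 := rfl
@[simp] lemma torus_zero_zero : torus t ht 0 0 = t := rfl
@[simp] lemma torus_zero_one : torus t ht 0 1 = 0 := rfl
@[simp] lemma torus_one_zero : torus t ht 1 0 = 0 := rfl
@[simp] lemma torus_one_one : torus t ht 1 1 = t⁻¹ := rfl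

variable [CharP K 2]

@[simp] lemma swap_zero_zero : swap (K := K) 0 0 = 0 := rfl
@[simp] lemma swap_zero_one : swap (K := K) 0 1 = 1 := rfl
@[simp] lemma swap_one_zero : swap (K := K) 1 0 = 1 := rfl
@[simp] lemma swap_one_one : swap (K := K) 1 1 = 0 := rfl

end Entries

lemma upper_injective : Function.Injective (upper (K := K)) := fun x y h => by
  simpa using congrArg (fun A : SpecialLinearGroup (Fin 2) K => A 0 1) h

lemma upper_add (x y : K) : upper (x + y) = upper x * upper y := by
  simp [ext_iff_entries, mul_entry, add_comm]

lemma upper_zero : upper (0 : K) = 1 := by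
  simp [ext_iff_entries]

lemma torus_mul_upper (t : K) (ht : t ≠ 0) (x : K) :
    torus t ht * upper x = upper (t ^ 2 * x) * torus t ht := by
  simp only [ext_iff_entries, mul_entry, upper_zero_zero, upper_zero_one, upper_one_zero,
    upper_one_one, torus_zero_zero, torus_zero_one, torus_one_zero, torus_one_one]
  refine ⟨by ring, ?_, by ring, by ring⟩
  field_simp
  ring

lemma map_upper (σ : K →+* K) (x : K) :
    SpecialLinearGroup.map σ (upper x) = upper (σ x) := by
  simp [ext_iff_entries, SpecialLinearGroup.map_apply_coe]

lemma eq_sq_mul_of_mul_upper {M : SpecialLinearGroup (Fin 2) K} {x y : K}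
    (h : M * upper x = upper y * M) : y = M 0 0 ^ 2 * x := by
  have hd := det_entries M
  simp only [ext_iff_entries, mul_entry, upper_zero_zero, upper_zero_one, upper_one_zero,
    upper_one_one] at h
  grind

variable [CharP K 2]

lemma swap_mul_swap : swap (K := K) * swap = 1 := by
  simp [ext_iff_entries, mul_entry]

lemma map_swap (σ : K →+* K) : SpecialLinearGroup.map σ swap = swap := by
  simp [ext_iff_entries, SpecialLinearGroup.map_apply_coe]

lemma swap_braid : swap (K := K) * upper 1 * swap = upper 1 * swap * upper 1 := by
  simp [ext_iff_entries, mul_entry, CharTwo.add_self_eq_zero]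

lemma swap_mul_upper_one_ne : swap (K := K) * upper 1 ≠ upper 1 * swap := by
  simp [ext_iff_entries, mul_entry]

lemma eq_upper_mul_swap_mul {A : SpecialLinearGroup (Fin 2) K} (h : A 1 0 ≠ 0) :
    A = upper ((A 0 0 - 1) / A 1 0) * (swap * upper (A 1 0) * swap) *
      upper ((A 1 1 - 1) / A 1 0) := by
  have hd := det_entries A
  simp only [ext_iff_entries, mul_entry, upper_zero_zero, upper_zero_one, upper_one_zero,
    upper_one_one, swap_zero_zero, swap_zero_one, swap_one_zero, swap_one_one]
  refine ⟨?_, ?_, ?_, ?_⟩ <;> field_simp <;> grind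

/-- In characteristic two, `SL₂` is generated by the upper unitriangular matrices and `swap`. -/
lemma monoidHom_ext {G : Type*} [Group G] {f g : SpecialLinearGroup (Fin 2) K →* G}
    (hu : ∀ x, f (upper x) = g (upper x)) (hs : f swap = g swap) (A) : f A = g A := by
  have key : ∀ B : SpecialLinearGroup (Fin 2) K, B 1 0 ≠ 0 → f B = g B := fun B hB => by
    rw [eq_upper_mul_swap_mul hB]
    simp only [map_mul, hu, hs]
  by_cases h : A 1 0 = 0
  · have hA : (swap * A : SpecialLinearGroup (Fin 2) K) 1 0 ≠ 0 := by
      have hd := det_entries A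
      simp only [mul_entry, swap_one_zero, swap_one_one]
      grind
    have := key _ hA
    rw [map_mul, map_mul, hs] at this
    exact mul_left_cancel this
  · exact key A h

lemma eq_upper_of_commute {M : SpecialLinearGroup (Fin 2) K}
    (h : M * upper 1 = upper 1 * M) : M = upper (M 0 1) := by
  have hd := det_entries M
  simp only [ext_iff_entries, mul_entry, upper_zero_zero, upper_zero_one, upper_one_zero,
    upper_one_one] at h ⊢
  have h2 : (2 : K) = 0 := CharTwo.two_eq_zero
  have h0 : M 1 0 = 0 := by grind
  have h1 : (M 0 0 - 1) ^ 2 = 0 := by grind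
  have h1' : M 0 0 - 1 = 0 := pow_eq_zero_iff (two_ne_zero) |>.1 h1
  grind

/-- An involution satisfying the braid relation with `upper 1` is conjugate to `swap` by an upper
unitriangular matrix. -/
lemma exists_upper_mul_swap {M : SpecialLinearGroup (Fin 2) K} (hM : M * M = 1)
    (hb : M * upper 1 * M = upper 1 * M * upper 1) (hc : M * upper 1 ≠ upper 1 * M) :
    M * upper (M 0 0) = upper (M 0 0) * swap := by
  have h2 : (2 : K) = 0 := CharTwo.two_eq_zero
  have hd := det_entries M
  have h0 : M 1 0 ≠ 0 := by
    intro h0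
    apply hc
    simp only [ext_iff_entries, mul_entry, upper_zero_zero, upper_zero_one, upper_one_zero,
      upper_one_one, one_zero_zero, one_zero_one, one_one_zero, one_one_one] at hM ⊢
    have h1 : (M 0 0 - 1) ^ 2 = 0 := by grind
    have h1' : M 0 0 - 1 = 0 := pow_eq_zero_iff (two_ne_zero) |>.1 h1
    grind
  simp only [ext_iff_entries, mul_entry, upper_zero_zero, upper_zero_one, upper_one_zero,
    upper_one_one, swap_zero_zero, swap_zero_one, swap_one_zero, swap_one_one,
    one_zero_zero, one_zero_one, one_one_zero, one_one_one] at hM hb ⊢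
  have ht : M 0 0 + M 1 1 = 0 := by
    apply mul_left_cancel₀ h0
    grind
  have h1 : M 1 0 = 1 := by
    apply mul_left_cancel₀ h0
    grind
  grind

/-- Every involution of `SL₂` over a perfect field of characteristic two is conjugate to
`upper 1`. -/
lemma exists_conj_upper_one [PerfectRing K 2] {M : SpecialLinearGroup (Fin 2) K}
    (hM : M * M = 1) (h1 : M ≠ 1) :
    ∃ g : SpecialLinearGroup (Fin 2) K, M * g = g * upper 1 := by
  have h2 : (2 : K) = 0 := CharTwo.two_eq_zero
  have hd := det_entries M
  have hsq : ∀ c : K, ∃ s, s ^ 2 = c := fun c =>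
    (PerfectRing.bijective_frobenius (R := K) (p := 2)).2 c
  simp only [ext_iff_entries, mul_entry, one_zero_zero, one_zero_one, one_one_zero,
    one_one_one, ne_eq] at hM h1
  by_cases hc : M 1 0 = 0
  · have ha : (M 0 0 - 1) ^ 2 = 0 := by grind
    have ha' : M 0 0 - 1 = 0 := pow_eq_zero_iff (two_ne_zero) |>.1 ha
    obtain ⟨s, hs⟩ := hsq (M 0 1)
    have hs0 : s ≠ 0 := by
      rintro rfl
      grind
    refine ⟨torus s hs0, ?_⟩
    simp only [ext_iff_entries, mul_entry, upper_zero_zero, upper_zero_one, upper_one_zero,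
      upper_one_one, torus_zero_zero, torus_zero_one, torus_one_zero, torus_one_one]
    refine ⟨by grind, ?_, by grind, by grind⟩
    field_simp
    grind
  · have ht : M 0 0 + M 1 1 = 0 := by
      apply mul_left_cancel₀ hc
      grind
    obtain ⟨s, hs⟩ := hsq (M 1 0)
    have hs0 : s ≠ 0 := by
      rintro rfl
      grind
    obtain ⟨g, h₁, h₂, h₃, h₄⟩ := exists_of_entries (a := (M 0 0 + 1) / s) (b := 1 / s) (c := s)
      (d := 0) (by field_simp; grind)
    refine ⟨g, ?_⟩
    simp only [ext_iff_entries, mul_entry, upper_zero_zero, upper_zero_one, upper_one_zero,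
      upper_one_one, h₁, h₂, h₃, h₄]
    refine ⟨?_, ?_, ?_, ?_⟩ <;> field_simp <;> grind

/-- An endomorphism of `SL₂` fixing `upper 1` acts on the upper unitriangular matrices
through a field endomorphism. -/
lemma exists_ringHom_map_upper [PerfectRing K 2]
    (ψ : SpecialLinearGroup (Fin 2) K →* SpecialLinearGroup (Fin 2) K)
    (h1 : ψ (upper 1) = upper 1) :
    ∃ σ : K →+* K, ∀ x, ψ (upper x) = upper (σ x) := by
  have hψ : ∀ x, ψ (upper x) = upper (ψ (upper x) 0 1) := fun x => by
    apply eq_upper_of_commute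
    rw [← h1, ← map_mul, ← map_mul, ← upper_add, ← upper_add, add_comm]
  choose f hf using fun x => (⟨_, hψ x⟩ : ∃ y, ψ (upper x) = upper y)
  have hf1 : f 1 = 1 := upper_injective ((hf 1).symm.trans h1)
  have hf0 : f 0 = 0 := upper_injective <| by rw [← hf, upper_zero, map_one]
  have hadd : ∀ x y, f (x + y) = f x + f y := fun x y => upper_injective <| by
    rw [← hf, upper_add, map_mul, hf, hf, upper_add]
  have hmul : ∀ x y, f (x * y) = f x * f y := fun x y => by
    obtain ⟨t, rfl⟩ : ∃ t, t ^ 2 = x :=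
      (PerfectRing.bijective_frobenius (R := K) (p := 2)).2 x
    by_cases ht : t = 0
    · simp [ht, hf0]
    have hscale : ∀ z, f (t ^ 2 * z) = ψ (torus t ht) 0 0 ^ 2 * f z := fun z => by
      apply eq_sq_mul_of_mul_upper
      rw [← hf, ← hf, ← map_mul, torus_mul_upper, map_mul]
    have := hscale 1
    rw [mul_one, hf1, mul_one] at this
    rw [hscale, this]
  exact ⟨⟨⟨⟨f, hf1⟩, hmul⟩, hf0, hadd⟩, hf⟩

/-- Every automorphism of `SL₂` over a finite field of characteristic two is the composite of an
inner automorphism and a field automorphism. -/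
theorem exists_conj_map [Finite K] (φ : MulAut (SpecialLinearGroup (Fin 2) K)) :
    ∃ (g : SpecialLinearGroup (Fin 2) K) (σ : K ≃+* K), ∀ A,
      φ A = g * SpecialLinearGroup.map (σ : K →+* K) A * g⁻¹ := by
  have huu : upper (1 : K) * upper 1 = 1 := by
    rw [← upper_add, CharTwo.add_self_eq_zero, upper_zero]
  have hu1 : upper (1 : K) ≠ 1 := by
    rw [← upper_zero]
    exact upper_injective.ne one_ne_zero
  obtain ⟨g, hg⟩ := exists_conj_upper_one (M := φ (upper 1)) (by rw [← map_mul, huu, map_one])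
    (by simpa using hu1)
  let ψ : MulAut (SpecialLinearGroup (Fin 2) K) := (MulAut.conj g)⁻¹ * φ
  have hψ : ∀ A, ψ A = g⁻¹ * φ A * g := fun A => by simp [ψ]
  have hψ1 : ψ (upper 1) = upper 1 := by rw [hψ, mul_assoc, hg, inv_mul_cancel_left]
  obtain ⟨σ, hσ⟩ := exists_ringHom_map_upper ψ.toMonoidHom hψ1
  replace hσ : ∀ x, ψ (upper x) = upper (σ x) := hσ
  have hbij : Function.Bijective σ := Finite.injective_iff_bijective.1 σ.injective
  have hswap := exists_upper_mul_swap (M := ψ swap)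
    (by rw [← map_mul, swap_mul_swap, map_one])
    (by rw [← hψ1, ← map_mul, ← map_mul, swap_braid, map_mul, map_mul])
    (by
      rw [← hψ1, ← map_mul, ← map_mul]
      exact ψ.injective.ne swap_mul_upper_one_ne)
  set v := upper (ψ swap 0 0) with hv
  refine ⟨g * v, RingEquiv.ofBijective σ hbij, fun A => ?_⟩
  refine monoidHom_ext (f := φ.toMonoidHom) (g := (MulAut.conj (g * v)).toMonoidHom.comp
    (SpecialLinearGroup.map (RingEquiv.ofBijective σ hbij : K →+* K))) (fun x => ?_) ?_ A
  · change φ (upper x) = g * v * SpecialLinearGroup.map _ (upper x) * (g * v)⁻¹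
    have hcomm : v * upper (σ x) = upper (σ x) * v := by
      rw [hv, ← upper_add, ← upper_add, add_comm]
    have h := hψ (upper x)
    rw [hσ] at h
    rw [map_upper]
    change φ (upper x) = g * v * upper (σ x) * (g * v)⁻¹
    rw [mul_assoc g, hcomm, h]
    group
  · change φ swap = g * v * SpecialLinearGroup.map _ swap * (g * v)⁻¹
    rw [map_swap, mul_assoc g, ← hswap, hψ]
    group

end SLTwoCharTwo


/-- Every automorphism of `SL₂(F₈)` is the composite of an inner automorphism with the
automorphism induced by entrywise application of a field automorphism of `F₈`. -/
theorem stmt_10 (φ : MulAut (Matrix.SpecialLinearGroup (Fin 2) (GaloisField 2 3))) :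
    ∃ (g : Matrix.SpecialLinearGroup (Fin 2) (GaloisField 2 3))
      (σ : GaloisField 2 3 ≃+* GaloisField 2 3),
      ∀ A : Matrix.SpecialLinearGroup (Fin 2) (GaloisField 2 3),
        φ A = g * Matrix.SpecialLinearGroup.map (σ : GaloisField 2 3 →+* GaloisField 2 3) A * g⁻¹ := by
  exact SLTwoCharTwo.exists_conj_map φ
end

section
/- The automorphism group of SL₂(F₈) has order 1512; equivalently, |Aut(SL₂(F₈))| = 3 · |SL₂(F₈)| = 3 · 504. -/
open Matrix MatrixGroups

namespace SL2

section CommRing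

variable {R : Type*} [CommRing R]

/-- The element of `SL(2, R)` with prescribed entries. -/
def ofEntries (a b c d : R) (h : a * d - b * c = 1) : SL(2, R) :=
  ⟨!![a, b; c, d], by rwa [det_fin_two_of]⟩

lemma ofEntries_inj {a b c d a' b' c' d' : R} {h : a * d - b * c = 1}
    {h' : a' * d' - b' * c' = 1} :
    ofEntries a b c d h = ofEntries a' b' c' d' h' ↔ a = a' ∧ b = b' ∧ c = c' ∧ d = d' := by
  refine Subtype.ext_iff.trans ?_
  change !![a, b; c, d] = !![a', b'; c', d'] ↔ _
  simp [and_assoc]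

lemma ofEntries_mul {a b c d a' b' c' d' : R} {h : a * d - b * c = 1}
    {h' : a' * d' - b' * c' = 1} :
    ofEntries a b c d h * ofEntries a' b' c' d' h' =
      ofEntries (a * a' + b * c') (a * b' + b * d') (c * a' + d * c') (c * b' + d * d')
        (by linear_combination a' * d' * h - b' * c' * h + h') := by
  apply Subtype.ext
  exact Matrix.mul_fin_two a b c d a' b' c' d'

lemma one_eq_ofEntries : (1 : SL(2, R)) = ofEntries 1 0 0 1 (by simp) :=
  Subtype.ext Matrix.one_fin_two

lemma ofEntries_surj (g : SL(2, R)) : ∃ a b c d h, g = ofEntries a b c d h := by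
  induction g using SpecialLinearGroup.fin_two_induction with
  | h a b c d h => exact ⟨a, b, c, d, h, rfl⟩

lemma map_ofEntries {S : Type*} [CommRing S] (f : R →+* S) {a b c d : R}
    {h : a * d - b * c = 1} :
    SpecialLinearGroup.map f (ofEntries a b c d h) =
      ofEntries (f a) (f b) (f c) (f d) (by rw [← map_mul, ← map_mul, ← map_sub, h, map_one]) := by
  apply Subtype.ext
  ext i j
  fin_cases i <;> fin_cases j <;> rfl

/-- The upper unitriangular matrix with corner entry `b`. -/
def upper (b : R) : SL(2, R) := ofEntries 1 b 0 1 (by simp)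

/-- The diagonal matrix with mutually inverse entries `a` and `b`. -/
def diag (a b : R) (h : a * b = 1) : SL(2, R) := ofEntries a 0 0 b (by simp [h])

/-- The standard Weyl element. -/
def weyl : SL(2, R) := ofEntries 0 1 (-1) 0 (by simp)

lemma upper_mul_upper (b c : R) : upper b * upper c = upper (b + c) := by
  simp [upper, ofEntries_mul, add_comm]

/-- The automorphism of `SL(2, R)` induced by a ring automorphism of `R`. -/
def mapAut (σ : R ≃+* R) : MulAut SL(2, R) :=
  MonoidHom.toMulEquiv (SpecialLinearGroup.map (σ : R →+* R))
    (SpecialLinearGroup.map (σ.symm : R →+* R))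
    (by
      ext g : 1
      obtain ⟨a, b, c, d, h, rfl⟩ := ofEntries_surj g
      simp [map_ofEntries])
    (by
      ext g : 1
      obtain ⟨a, b, c, d, h, rfl⟩ := ofEntries_surj g
      simp [map_ofEntries])

lemma mapAut_ofEntries (σ : R ≃+* R) {a b c d : R} {h : a * d - b * c = 1} :
    mapAut σ (ofEntries a b c d h) =
      ofEntries (σ a) (σ b) (σ c) (σ d) (by rw [← map_mul, ← map_mul, ← map_sub, h, map_one]) :=
  map_ofEntries (σ : R →+* R)

lemma mapAut_upper (σ : R ≃+* R) (b : R) : mapAut σ (upper b) = upper (σ b) := by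
  simp [upper, mapAut_ofEntries]

lemma mapAut_weyl (σ : R ≃+* R) : mapAut σ (weyl : SL(2, R)) = weyl := by
  simp [weyl, mapAut_ofEntries]

lemma mapAut_diag (σ : R ≃+* R) {a b : R} (h : a * b = 1) :
    mapAut σ (diag a b h) = diag (σ a) (σ b) (by rw [← map_mul, h, map_one]) := by
  simp [diag, mapAut_ofEntries]

lemma diag_mul_diag {a b : R} (h : a * b = 1) : diag a b h * diag b a (by rwa [mul_comm]) = 1 := by
  simp [diag, ofEntries_mul, one_eq_ofEntries, mul_comm b a, h]

lemma diag_pow {a b : R} (h : a * b = 1) (n : ℕ) :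
    diag a b h ^ n = diag (a ^ n) (b ^ n) (by rw [← mul_pow, h, one_pow]) := by
  induction n with
  | zero => simp [diag, one_eq_ofEntries]
  | succ n ih =>
    rw [pow_succ, ih]
    simp [pow_succ, diag, ofEntries_mul]

lemma diag_mul_upper_mul_diag {a b : R} (h : a * b = 1) (x : R) :
    diag a b h * upper x * diag b a (by rwa [mul_comm]) = upper (a ^ 2 * x) := by
  simp only [diag, upper, ofEntries_mul, ofEntries_inj]
  grind

end CommRing

section Field

variable {F : Type*} [Field F]

lemma closure_upper_weyl :
    Subgroup.closure (insert weyl (Set.range upper)) = (⊤ : Subgroup SL(2, F)) := by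
  set H := Subgroup.closure (insert weyl (Set.range upper) : Set SL(2, F))
  have hw : weyl ∈ H := Subgroup.subset_closure (Set.mem_insert _ _)
  have hu (b : F) : upper b ∈ H :=
    Subgroup.subset_closure (Set.mem_insert_of_mem _ (Set.mem_range_self b))
  have of_ne {a b c d : F} (h : a * d - b * c = 1) (hc : c ≠ 0) : ofEntries a b c d h ∈ H := by
    have e : ofEntries a b c d h =
        upper ((a - 1) / c) * (weyl * upper (-c) * weyl⁻¹) * upper ((d - 1) / c) := by
      have : (weyl : SL(2, F))⁻¹ = ofEntries 0 (-1) 1 0 (by simp) :=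
        inv_eq_of_mul_eq_one_right (by
          simp [weyl, ofEntries_mul, one_eq_ofEntries])
      rw [this]
      simp only [upper, weyl, ofEntries_mul, ofEntries_inj]
      refine ⟨?_, ?_, ?_, ?_⟩ <;> field_simp <;> grind
    rw [e]
    exact mul_mem (mul_mem (hu _) (mul_mem (mul_mem hw (hu _)) (inv_mem hw))) (hu _)
  refine eq_top_iff.2 fun g _ ↦ ?_
  obtain ⟨a, b, c, d, h, rfl⟩ := ofEntries_surj g
  by_cases hc : c = 0
  · rw [← H.mul_mem_cancel_left hw, weyl, ofEntries_mul]
    exact of_ne _ (by rintro h'; grind)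
  · exact of_ne h hc

/-- An element of `SL(2, F)` whose trace is `ν + κ`, with `ν * κ = 1` and `ν ≠ κ`, is conjugate to the
diagonal matrix with entries `ν` and `κ`. -/
lemma exists_conj_diag {a b c d : F} (h : a * d - b * c = 1) {ν κ : F} (hi : ν * κ = 1)
    (hne : ν ≠ κ) (ht : a + d = ν + κ) :
    ∃ P : SL(2, F), ofEntries a b c d h = P * diag ν κ hi * P⁻¹ := by
  have eigen (x : F) (hx : x * x - (a + d) * x + 1 = 0) :
      ∃ p q, (p ≠ 0 ∨ q ≠ 0) ∧ a * p + b * q = x * p ∧ c * p + d * q = x * q := by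
    by_cases hb : b = 0
    · by_cases hc : c = 0
      · by_cases ha : a = x
        · exact ⟨1, 0, by simp, by grind, by grind⟩
        · exact ⟨0, 1, by simp, by grind, by grind⟩
      · exact ⟨x - d, c, by simp [hc], by grind, by grind⟩
    · exact ⟨b, x - a, by simp [hb], by grind, by grind⟩
  obtain ⟨p, q, h0, h1, h2⟩ := eigen ν (by grind)
  obtain ⟨r, s, h0', h1', h2'⟩ := eigen κ (by grind)
  have hne : κ - ν ≠ 0 := sub_ne_zero.2 hne.symm
  have hδ : p * s - r * q ≠ 0 := by
    intro e
    have e1 : p * r = 0 := mul_left_cancel₀ hne (by linear_combination b * e - p * h1' + r * h1)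
    have e2 : q * s = 0 := mul_left_cancel₀ hne (by linear_combination -c * e - q * h2' + s * h2)
    have e3 : q * r = 0 :=
      mul_left_cancel₀ hne (by linear_combination (-a + ν) * e - q * h1' + s * h1)
    grind
  refine ⟨ofEntries p (r / (p * s - r * q)) q (s / (p * s - r * q)) (by field_simp), ?_⟩
  rw [eq_mul_inv_iff_mul_eq]
  simp only [diag, ofEntries_mul, ofEntries_inj]
  refine ⟨?_, ?_, ?_, ?_⟩ <;> field_simp <;> grind

end Field

section CharTwo

variable {F : Type*} [Field F] [CharP F 2]

lemma weyl_mul_self : (weyl : SL(2, F)) * weyl = 1 := by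
  simp only [weyl, ofEntries_mul, one_eq_ofEntries, ofEntries_inj]
  grind

lemma eq_one_of_commute {k : SL(2, F)} (hu : k * upper 1 = upper 1 * k)
    (hw : k * weyl = weyl * k) : k = 1 := by
  obtain ⟨a, b, c, d, h, rfl⟩ := ofEntries_surj k
  simp only [upper, weyl, ofEntries_mul, one_eq_ofEntries, ofEntries_inj] at *
  have : (a - 1) ^ 2 = 0 := by grind
  have : a - 1 = 0 := by simpa using this
  grind

lemma conj_mul_mapAut_injective :
    Function.Injective fun x : SL(2, F) × (F ≃+* F) ↦ MulAut.conj x.1 * mapAut x.2 := by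
  rintro ⟨g, σ⟩ ⟨h, τ⟩ e
  have key (x : SL(2, F)) : g * mapAut σ x * g⁻¹ = h * mapAut τ x * h⁻¹ :=
    DFunLike.congr_fun e x
  have comm {x y : SL(2, F)} (hx : g * x * g⁻¹ = h * y * h⁻¹) : h⁻¹ * g * x = y * (h⁻¹ * g) := by
    rw [mul_inv_eq_iff_eq_mul] at hx
    rw [mul_assoc, hx]
    group
  have hu := comm (key (upper 1))
  have hw := comm (key weyl)
  rw [mapAut_upper, mapAut_upper, map_one, map_one] at hu
  rw [mapAut_weyl, mapAut_weyl] at hw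
  have hgh : h = g := inv_mul_eq_one.1 (eq_one_of_commute hu hw)
  subst hgh
  refine Prod.ext rfl (RingEquiv.ext fun b ↦ ?_)
  have hb := key (upper b)
  rw [mapAut_upper, mapAut_upper] at hb
  simpa [upper, ofEntries_inj] using hb

lemma exists_pow_eq (hF : ∀ x : F, x ^ 8 = x) {l : F} (hl : l ^ 3 = l + 1) {x : F} (hx : x ≠ 0) :
    ∃ n, l ^ n = x := by
  have h7 {y : F} (hy : y ≠ 0) : y ^ 7 = 1 :=
    mul_right_cancel₀ hy (by rw [← pow_succ, hF, one_mul])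
  have : Fact (Nat.Prime 7) := ⟨by norm_num⟩
  have hord : orderOf l = 7 := orderOf_eq_prime (h7 (by grind)) (by grind)
  obtain ⟨n, -, hn⟩ := (hord ▸ IsPrimitiveRoot.orderOf l).eq_pow_of_pow_eq_one (h7 hx)
  exact ⟨n, hn⟩

lemma eq_one_of_map_diag_of_map_upper (hF : ∀ x : F, x ^ 8 = x) {l m : F} (hl : l ^ 3 = l + 1)
    (hlm : l * m = 1) {ψ : MulAut SL(2, F)} (hψ : ψ (diag l m hlm) = diag l m hlm)
    (hu : ψ (upper 1) = upper 1) : ψ = 1 := by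
  have hψ' : ψ (diag m l (by rwa [mul_comm])) = diag m l (by rwa [mul_comm]) := by
    rw [← inv_eq_of_mul_eq_one_right (diag_mul_diag hlm), map_inv, hψ]
  have hupper (x : F) : ψ (upper x) = upper x := by
    by_cases hx : x = 0
    · have : upper x = 1 := by simp [hx, upper, one_eq_ofEntries]
      rw [this, map_one]
    · obtain ⟨n, rfl⟩ := exists_pow_eq hF hl hx
      have e : upper (l ^ n) =
          diag l m hlm ^ (4 * n) * upper 1 * diag m l (by rwa [mul_comm]) ^ (4 * n) := by
        rw [diag_pow, diag_pow, diag_mul_upper_mul_diag, mul_one, ← pow_mul, ← hF (l ^ n),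
          ← pow_mul]
        congr 2
        ring
      rw [e, map_mul, map_mul, map_pow, map_pow, hψ, hψ', hu]
  have hweyl : ψ weyl = weyl := by
    have h1 : ψ (weyl * weyl) = 1 := by rw [weyl_mul_self, map_one]
    have h2 : ψ (weyl * diag l m hlm) = ψ (diag m l (by rwa [mul_comm]) * weyl) := by
      congr 1
      simp [weyl, diag, ofEntries_mul]
    have h3 : ψ (weyl * upper 1 * (weyl * upper 1) * (weyl * upper 1)) = 1 := by
      rw [← map_one ψ]
      congr 1
      simp only [weyl, upper, ofEntries_mul, one_eq_ofEntries, ofEntries_inj]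
      grind
    simp only [map_mul, hψ, hψ', hu] at h1 h2 h3
    obtain ⟨a, b, c, d, h, e⟩ := ofEntries_surj (ψ weyl)
    rw [e] at h1 h2 h3 ⊢
    simp only [weyl, diag, upper, ofEntries_mul, one_eq_ofEntries, ofEntries_inj] at h1 h2 h3 ⊢
    have hne : l - m ≠ 0 := by grind
    have ha : a = 0 := mul_left_cancel₀ hne (by linear_combination h2.1)
    have hd : d = 0 := mul_left_cancel₀ hne (by linear_combination -h2.2.2.2)
    subst ha hd
    grind
  have : ψ.toMonoidHom = MonoidHom.id _ := by
    refine MonoidHom.eq_of_eqOn_dense closure_upper_weyl ?_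
    rintro _ (rfl | ⟨x, rfl⟩)
    exacts [hweyl, hupper x]
  exact MulEquiv.ext fun x ↦ DFunLike.congr_fun this x

/-- An automorphism of `SL(2, F)`, with `F` of order eight, that fixes a generator of the split
torus is inner. -/
lemma exists_eq_conj_of_map_diag (hF : ∀ x : F, x ^ 8 = x) {l m : F} (hl : l ^ 3 = l + 1)
    (hlm : l * m = 1) {ψ : MulAut SL(2, F)} (hψ : ψ (diag l m hlm) = diag l m hlm) :
    ∃ g, ψ = MulAut.conj g := by
  have hψ' : ψ (diag m l (by rwa [mul_comm])) = diag m l (by rwa [mul_comm]) := by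
    rw [← inv_eq_of_mul_eq_one_right (diag_mul_diag hlm), map_inv, hψ]
  obtain ⟨b, hb, hu⟩ : ∃ b, b ≠ 0 ∧ ψ (upper 1) = upper b := by
    have h1 : ψ (upper 1 * upper 1) = 1 := by
      rw [upper_mul_upper, ← map_one ψ]
      congr 1
      simp only [upper, one_eq_ofEntries, ofEntries_inj]
      grind
    have h2 : ψ (diag l m hlm * upper 1 * diag m l (by rwa [mul_comm]) * upper 1) =
        ψ (upper 1 * (diag l m hlm * upper 1 * diag m l (by rwa [mul_comm]))) := by
      rw [diag_mul_upper_mul_diag, upper_mul_upper, upper_mul_upper, add_comm]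
    have h3 : ψ (diag l m hlm ^ 3 * upper 1 * diag m l (by rwa [mul_comm]) ^ 3) =
        ψ (diag l m hlm * upper 1 * diag m l (by rwa [mul_comm]) * upper 1) := by
      rw [diag_pow, diag_pow, diag_mul_upper_mul_diag, diag_mul_upper_mul_diag, upper_mul_upper]
      congr 2
      grind
    have h4 : ψ (upper 1) ≠ 1 := by
      rw [Ne, EmbeddingLike.map_eq_one_iff]
      simp [upper, one_eq_ofEntries, ofEntries_inj]
    simp only [map_mul, map_pow, hψ, hψ'] at h1 h2 h3
    rw [diag_pow, diag_pow] at h3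
    obtain ⟨a, b, c, d, h, e⟩ := ofEntries_surj (ψ (upper 1))
    rw [e] at h1 h2 h3 h4 ⊢
    simp only [diag, upper, ofEntries_mul, one_eq_ofEntries, ofEntries_inj] at h1 h2 h3 h4 ⊢
    have hl4 : l ^ 4 - 1 ≠ 0 := by grind
    have hl0 : l ≠ 0 := by grind
    have had : (a - d) ^ 2 = 0 := by grind
    have had : a - d = 0 := by simpa using had
    have hbc : b * c = 0 := mul_left_cancel₀ hl4 (by grind)
    have ha : (a - 1) ^ 2 = 0 := by grind
    have ha : a - 1 = 0 := by simpa using ha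
    have hc : c = 0 := by
      rcases mul_eq_zero.1 hbc with hb | hc
      · grind
      · exact hc
    exact ⟨b, by grind, by grind⟩
  have hb' : b ^ 4 * (b⁻¹) ^ 4 = 1 := by rw [← mul_pow, mul_inv_cancel₀ hb, one_pow]
  refine ⟨diag (b ^ 4) (b⁻¹ ^ 4) hb', ?_⟩
  have hD : (diag (b ^ 4) (b⁻¹ ^ 4) hb')⁻¹ = diag (b⁻¹ ^ 4) (b ^ 4) (by rwa [mul_comm]) :=
    inv_eq_of_mul_eq_one_right (diag_mul_diag hb')
  refine (inv_mul_eq_one.1 (eq_one_of_map_diag_of_map_upper hF hl hlm ?_ ?_)).symm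
  · rw [MulAut.mul_apply, hψ, MulAut.conj_inv_apply, hD]
    simp only [diag, ofEntries_mul, ofEntries_inj]
    grind
  · rw [MulAut.mul_apply, hu, MulAut.conj_inv_apply, hD, diag_mul_upper_mul_diag, ← pow_mul,
      hF (b⁻¹), inv_mul_cancel₀ hb]

lemma ofEntries_sq {a b c d : F} (h : a * d - b * c = 1) :
    ofEntries a b c d h ^ 2 = ofEntries ((a + d) * a + 1) ((a + d) * b) ((a + d) * c)
      ((a + d) * d + 1) (by grind) := by
  rw [pow_two, ofEntries_mul, ofEntries_inj]
  grind

/-- The traces of the elements of order seven. -/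
lemma exists_trace_eq {l m : F} (hl : l ^ 3 = l + 1) (hlm : l * m = 1) {a b c d : F}
    (h : a * d - b * c = 1) (h7 : ofEntries a b c d h ^ 7 = 1) (h1 : ofEntries a b c d h ≠ 1) :
    ∃ i : ℕ, a + d = l ^ 2 ^ i + m ^ 2 ^ i := by
  have h8 : ((ofEntries a b c d h ^ 2) ^ 2) ^ 2 = ofEntries a b c d h := by
    rw [← pow_mul, ← pow_mul, pow_succ, h7, one_mul]
  rw [ofEntries_sq, ofEntries_sq, ofEntries_sq, ofEntries_inj] at h8
  rw [one_eq_ofEntries, Ne, ofEntries_inj] at h1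
  obtain ⟨ha, hb, hc, hd⟩ := h8
  obtain ⟨t, ht⟩ : ∃ t, t = a + d := ⟨_, rfl⟩
  have ht7 : t ^ 7 = 1 := by
    by_contra hne
    have hne : t ^ 7 - 1 ≠ 0 := sub_ne_zero.2 hne
    have hb : b = 0 := mul_left_cancel₀ hne (by grind)
    have hc : c = 0 := mul_left_cancel₀ hne (by grind)
    have ht : t = 0 := mul_left_cancel₀ hne (by grind)
    grind
  have h3 : (t ^ 3 + t ^ 2 + 1) ^ 2 = 0 := by grind
  have h3 : t ^ 3 + t ^ 2 + 1 = 0 := by simpa using h3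
  have hm : m = l ^ 2 + 1 := by grind
  have : (t - (l ^ 2 + l + 1)) * ((t - (l + 1)) * (t - (l ^ 2 + 1))) = 0 := by grind
  rw [← ht, hm]
  rcases mul_eq_zero.1 this with h | h
  · exact ⟨0, by grind⟩
  rcases mul_eq_zero.1 h with h | h
  · exact ⟨1, by grind⟩
  · exact ⟨2, by norm_num; grind⟩

lemma exists_cube_eq (hF : ∀ x : F, x ^ 8 = x) (hx : ∃ x : F, x ≠ 0 ∧ x ≠ 1) :
    ∃ l : F, l ^ 3 = l + 1 := by
  obtain ⟨x, h0, h1⟩ := hx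
  have : x * (x - 1) * ((x ^ 3 - x - 1) * (x ^ 3 - x ^ 2 - 1)) = 0 := by
    have := hF x
    grind
  rcases mul_eq_zero.1 ((mul_eq_zero.1 this).resolve_left (by grind)) with h | h
  · exact ⟨x, by grind⟩
  · exact ⟨x⁻¹, by grind⟩

lemma conj_mul_mapAut_surjective [Finite F] (hF : Nat.card F = 8) :
    Function.Surjective fun x : SL(2, F) × (F ≃+* F) ↦ MulAut.conj x.1 * mapAut x.2 := by
  have : Fintype F := Fintype.ofFinite F
  have hF' (x : F) : x ^ 8 = x := by
    rw [← hF, Nat.card_eq_fintype_card, FiniteField.pow_card]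
  obtain ⟨l, hl⟩ : ∃ l : F, l ^ 3 = l + 1 := by
    refine exists_cube_eq hF' ?_
    obtain ⟨x, y, z, h⟩ := Fintype.two_lt_card_iff.1
      (show 2 < Fintype.card F by rw [← Nat.card_eq_fintype_card, hF]; norm_num)
    by_contra! H
    have H' (x : F) : x = 0 ∨ x = 1 := or_iff_not_imp_left.2 (H x)
    rcases H' x with rfl | rfl <;> rcases H' y with rfl | rfl <;> rcases H' z with rfl | rfl <;>
      simp at h
  have hlm : l * l⁻¹ = 1 := mul_inv_cancel₀ (by grind)
  generalize l⁻¹ = m at hlm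
  intro φ
  obtain ⟨a, b, c, d, h, e⟩ := ofEntries_surj (φ (diag l m hlm))
  obtain ⟨i, hi⟩ := exists_trace_eq hl hlm h
    (by
      rw [← e, ← map_pow, diag_pow, EmbeddingLike.map_eq_one_iff, diag, one_eq_ofEntries,
        ofEntries_inj]
      grind)
    (by
      rw [← e, Ne, EmbeddingLike.map_eq_one_iff, diag, one_eq_ofEntries, ofEntries_inj]
      grind)
  set σ : F ≃+* F := iterateFrobeniusEquiv F 2 i
  have hσ (x : F) : σ x = x ^ 2 ^ i := iterateFrobeniusEquiv_def F 2 i x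
  rw [← hσ, ← hσ] at hi
  obtain ⟨P, hP⟩ := exists_conj_diag h (ν := σ l) (κ := σ m) (by rw [← map_mul, hlm, map_one])
    (σ.injective.ne (by grind)) hi
  obtain ⟨g, hg⟩ := exists_eq_conj_of_map_diag hF' hl hlm
    (ψ := (MulAut.conj P * mapAut σ)⁻¹ * φ) (by
      rw [MulAut.mul_apply, e, hP, ← mapAut_diag]
      exact MulAut.inv_apply_self _ _ _)
  refine ⟨(P * mapAut σ g, σ), ?_⟩
  rw [inv_mul_eq_iff_eq_mul] at hg
  rw [hg]
  ext x : 1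
  simp [mul_assoc]

end CharTwo

section Card

lemma card_sl_mul_card_units (F : Type*) [Field F] :
    Nat.card SL(2, F) * Nat.card Fˣ = Nat.card (GL (Fin 2) F) := by
  have hker : (GeneralLinearGroup.det : GL (Fin 2) F →* Fˣ).ker =
      (SpecialLinearGroup.toGL : SL(2, F) →* GL (Fin 2) F).range := by
    ext g
    rw [MonoidHom.mem_ker, MonoidHom.mem_range]
    constructor
    · intro h
      exact ⟨⟨g.1, congrArg Units.val h⟩, Units.ext rfl⟩
    · rintro ⟨A, rfl⟩
      exact Units.ext A.2
  have hsurj : Function.Surjective (GeneralLinearGroup.det : GL (Fin 2) F →* Fˣ) := fun u ↦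
    ⟨GeneralLinearGroup.mkOfDetNeZero !![(u : F), 0; 0, 1] (by simp), Units.ext (by
      simp [GeneralLinearGroup.mkOfDetNeZero])⟩
  rw [Subgroup.card_eq_card_quotient_mul_card_subgroup
      (GeneralLinearGroup.det : GL (Fin 2) F →* Fˣ).ker,
    Nat.card_congr (QuotientGroup.quotientKerEquivOfSurjective _ hsurj).toEquiv, hker,
    ← Nat.card_congr (MonoidHom.ofInjective SpecialLinearGroup.toGL_injective).toEquiv, mul_comm]

lemma card_sl {F : Type*} [Field F] [Finite F] (hF : Nat.card F = 8) :
    Nat.card SL(2, F) = 504 := by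
  have : Fintype F := Fintype.ofFinite F
  have h := card_sl_mul_card_units F
  rw [Matrix.card_GL_field, Nat.card_units, ← Nat.card_eq_fintype_card, hF, Fin.prod_univ_two] at h
  norm_num at h
  lia

lemma card_ringAut_galoisField (p n : ℕ) [Fact p.Prime] (hn : n ≠ 0) :
    Nat.card (GaloisField p n ≃+* GaloisField p n) = n := by
  have e : Gal(GaloisField p n/ZMod p) ≃ (GaloisField p n ≃+* GaloisField p n) :=
    { toFun := fun σ ↦ σ
      invFun := fun σ ↦ AlgEquiv.ofRingEquiv (f := σ) fun x ↦
        DFunLike.congr_fun (Subsingleton.elim ((σ : GaloisField p n →+* GaloisField p n).comp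
          (algebraMap (ZMod p) (GaloisField p n))) (algebraMap _ _)) x
      left_inv := fun _ ↦ rfl
      right_inv := fun _ ↦ rfl }
  rw [← Nat.card_congr e, IsGalois.card_aut_eq_finrank, GaloisField.finrank p hn]

end Card

end SL2

/-- The automorphism group of `SL₂(F₈)` has order `1512 = 3 · 504`. -/
theorem stmt_11 :
    Nat.card (MulAut (Matrix.SpecialLinearGroup (Fin 2) (GaloisField 2 3))) = 1512 ∧
    1512 = 3 * Nat.card (Matrix.SpecialLinearGroup (Fin 2) (GaloisField 2 3)) ∧
    Nat.card (Matrix.SpecialLinearGroup (Fin 2) (GaloisField 2 3)) = 504 := by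
  have hF : Nat.card (GaloisField 2 3) = 8 := GaloisField.card 2 3 (by norm_num)
  refine ⟨?_, by rw [SL2.card_sl hF], SL2.card_sl hF⟩
  rw [← Nat.card_congr (Equiv.ofBijective _
      ⟨SL2.conj_mul_mapAut_injective, SL2.conj_mul_mapAut_surjective hF⟩),
    Nat.card_prod, SL2.card_sl hF, SL2.card_ringAut_galoisField 2 3 (by norm_num)]
end
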